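/- Let q be a prime power, n a positive integer, and Δ ∈ M_n(𝔽_q). If α = (α1,…,αℓ) and α' = (α'_1,…,α'_ℓ) are weak compositions of n such that the sequence α' is a rearrangement (permutation) of the sequence α, then X_α(Δ) = X_{α'}(Δ). -/

import Mathlib

open Matrix Module Polynomial

attribute [local instance] Classical.propDecidable

/-- `μ` is a partition: its parts are weakly decreasing. -/
def IsPtn (μ : ℕ →₀ ℕ) : Prop := ∀ i, μ (i + 1) ≤ μ i

/-- The size `|μ|` of a partition. -/
def ptnSize (μ : ℕ →₀ ℕ) : ℕ := μ.sum fun _ v => v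

/-- `W + ΔW + ⋯ + Δ^{j-1}W`. -/
noncomputable def iterSpan {F : Type} [Field F] {n : ℕ} (Δ : Matrix (Fin n) (Fin n) F)
    (W : Submodule F (Fin n → F)) (j : ℕ) : Submodule F (Fin n → F) :=
  ⨆ i ∈ Finset.range j, W.map (Δ ^ i).mulVecLin

/-- `W` has `Δ`-profile `μ`. -/
def HasProfile {F : Type} [Field F] {n : ℕ} (Δ : Matrix (Fin n) (Fin n) F)
    (μ : ℕ →₀ ℕ) (W : Submodule F (Fin n → F)) : Prop :=
  ∀ j : ℕ, Module.finrank F (iterSpan Δ W (j + 1)) = ∑ i ∈ Finset.range (j + 1), μ i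

/-- `σ(μ, Δ)`: the number of subspaces with `Δ`-profile `μ`. -/
noncomputable def sigmaProf {F : Type} [Field F] {n : ℕ} (μ : ℕ →₀ ℕ)
    (Δ : Matrix (Fin n) (Fin n) F) : ℕ :=
  Nat.card {W : Submodule F (Fin n → F) // HasProfile Δ μ W}

/-- `X_α(Δ)`: the number of flags of `Δ`-invariant subspaces with successive
quotient dimensions given by `α`. -/
noncomputable def Xflag {F : Type} [Field F] {n ℓ : ℕ} (Δ : Matrix (Fin n) (Fin n) F)
    (α : Fin ℓ → ℕ) : ℕ :=
  Nat.card {W : Fin (ℓ + 1) → Submodule F (Fin n → F) //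
    Monotone W ∧ W 0 = ⊥ ∧ W (Fin.last ℓ) = ⊤ ∧
    (∀ i, (W i).map Δ.mulVecLin ≤ W i) ∧
    ∀ i : Fin ℓ, Module.finrank F (W i.succ) = Module.finrank F (W i.castSucc) + α i}

/-- The Gaussian binomial coefficient as a polynomial in `t`. -/
noncomputable def qbp : ℕ → ℕ → Polynomial ℤ
  | _, 0 => 1
  | 0, _ + 1 => 0
  | a + 1, b + 1 => qbp a b + Polynomial.X ^ (b + 1) * qbp a (b + 1)

/-- The `q`-integer `[m]_t`. -/
def qNat (t : ℚ) (m : ℕ) : ℚ := ∑ i ∈ Finset.range m, t ^ i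

/-- The `q`-factorial `[m]_t!`. -/
def qFact (t : ℚ) (m : ℕ) : ℚ := ∏ i ∈ Finset.range m, qNat t (i + 1)


lemma exists_functional {F : Type*} [Field F] (f : F[X]) (hf : f ≠ 0) :
    ∃ l : (F[X] ⧸ Ideal.span {f}) →ₗ[F] F, ∀ a, a ≠ 0 → ∃ b, l (a * b) ≠ 0 := by
  classical
  obtain ⟨g, hg, hI⟩ : ∃ g : F[X], g.Monic ∧ Ideal.span {f} = Ideal.span {g} :=
    ⟨normalize f, Polynomial.monic_normalize hf,
      Ideal.span_singleton_eq_span_singleton.2 (associated_normalize f)⟩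
  rw [hI]
  refine ⟨(Polynomial.lcoeff F (g.natDegree - 1)).comp (AdjoinRoot.modByMonicHom hg), ?_⟩
  intro a ha
  obtain ⟨h, rfl⟩ := Ideal.Quotient.mk_surjective a
  set r := h %ₘ g with hr
  have hmk : Ideal.Quotient.mk (Ideal.span {g}) h = Ideal.Quotient.mk (Ideal.span {g}) r := by
    rw [Ideal.Quotient.mk_eq_mk_iff_sub_mem, Ideal.mem_span_singleton]
    exact ⟨h /ₘ g, by rw [hr]; linear_combination - Polynomial.modByMonic_add_div h g⟩
  have hr0 : r ≠ 0 := by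
    intro h0; apply ha; rw [hmk, h0, map_zero]
  have hg1 : g ≠ 1 := by
    rintro rfl; apply hr0; simp [hr]
  have hlt : r.natDegree < g.natDegree := Polynomial.natDegree_modByMonic_lt h hg hg1
  refine ⟨Ideal.Quotient.mk _ (X ^ (g.natDegree - 1 - r.natDegree)), ?_⟩
  rw [hmk, ← map_mul]
  change (AdjoinRoot.modByMonicHom hg (AdjoinRoot.mk g (r * X ^ (g.natDegree - 1 - r.natDegree)))).coeff
    (g.natDegree - 1) ≠ 0
  have : AdjoinRoot.modByMonicHom hg (AdjoinRoot.mk g (r * X ^ (g.natDegree - 1 - r.natDegree)))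
      = r * X ^ (g.natDegree - 1 - r.natDegree) := by
    rw [AdjoinRoot.modByMonicHom_mk, Polynomial.modByMonic_eq_self_iff hg]
    apply Polynomial.degree_lt_degree
    rw [Polynomial.natDegree_mul_X_pow _ hr0]; omega
  rw [this, show g.natDegree - 1 = r.natDegree + (g.natDegree - 1 - r.natDegree) by omega]
  rw [show r.natDegree + (g.natDegree - 1 - r.natDegree) - r.natDegree = g.natDegree - 1 - r.natDegree by omega]
  rw [Polynomial.coeff_mul_X_pow]
  simpa using hr0

lemma exists_form {F V : Type*} [Field F] [AddCommGroup V] [Module F V] [FiniteDimensional F V]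
    (T : V →ₗ[F] V) : ∃ B : V →ₗ[F] Dual F V, Function.Injective B ∧
      ∀ x y, B (T x) y = B x (T y) := by
  classical
  have ht : Module.IsTorsion F[X] (Module.AEval' T) :=
    Module.AEval.isTorsion_of_finiteDimensional F V T
  obtain ⟨ι, _, p, hp, k, ⟨e⟩⟩ := Module.equiv_directSum_of_isTorsion ht
  have hfun : ∀ i, ∃ l : (F[X] ⧸ Ideal.span {p i ^ k i}) →ₗ[F] F,
      ∀ a, a ≠ 0 → ∃ b, l (a * b) ≠ 0 :=
    fun i => exists_functional _ (pow_ne_zero _ (hp i).ne_zero)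
  choose l hl using hfun
  let E : V → ∀ i, F[X] ⧸ Ideal.span {p i ^ k i} := fun v i => e (Module.AEval'.of T v) i
  have Eadd : ∀ x y i, E (x + y) i = E x i + E y i := by intro x y i; simp [E]
  have Esmul : ∀ (c : F) x i, E (c • x) i = c • E x i := by
    intro c x i
    have : Module.AEval'.of T (c • x) = (C c : F[X]) • Module.AEval'.of T x := by
      simp [Module.AEval.C_smul]
    simp only [E, this, map_smul]
    rw [DirectSum.smul_apply, ← Polynomial.algebraMap_eq, algebraMap_smul]
  have ET : ∀ x i, E (T x) i = Ideal.Quotient.mk _ X * E x i := by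
    intro x i
    have : Module.AEval'.of T (T x) = (X : F[X]) • Module.AEval'.of T x := by
      rw [Module.AEval'.X_smul_of]
    simp only [E, this, map_smul]
    rw [DirectSum.smul_apply]
    rfl
  have sm : ∀ (c : F) (i) (a b : F[X] ⧸ Ideal.span {p i ^ k i}), (c • a) * b = c • (a * b) := by
    intro c i a b
    obtain ⟨a, rfl⟩ := Ideal.Quotient.mk_surjective a
    obtain ⟨b, rfl⟩ := Ideal.Quotient.mk_surjective b
    exact congrArg (Ideal.Quotient.mk _) (smul_mul_assoc c a b)
  have ms : ∀ (c : F) (i) (a b : F[X] ⧸ Ideal.span {p i ^ k i}), a * (c • b) = c • (a * b) := by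
    intro c i a b
    rw [mul_comm, sm, mul_comm]
  refine ⟨LinearMap.mk₂ F (fun x y => ∑ i, l i (E x i * E y i)) ?_ ?_ ?_ ?_, ?_, ?_⟩
  · intro x y z; simp [Eadd, add_mul, Finset.sum_add_distrib]
  · intro c x y; simp [Esmul, sm, ms, Finset.mul_sum]
  · intro x y z; simp [Eadd, mul_add, Finset.sum_add_distrib]
  · intro c x y; simp [Esmul, sm, ms, Finset.mul_sum]
  · rw [injective_iff_map_eq_zero]
    intro x hx
    by_contra hne
    have : ∃ i, E x i ≠ 0 := by
      by_contra! h
      apply hne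
      have : e (Module.AEval'.of T x) = 0 := by
        ext1 i; exact h i
      simpa using this
    obtain ⟨i, hi⟩ := this
    obtain ⟨b, hb⟩ := hl i _ hi
    obtain ⟨y, hy⟩ : ∃ y : V, Module.AEval'.of T y = e.symm (DirectSum.of (fun i => F[X] ⧸ Ideal.span {p i ^ k i}) i b) :=
      (Module.AEval'.of T).surjective _
    have hEy : ∀ j, E y j = DirectSum.of (fun i => F[X] ⧸ Ideal.span {p i ^ k i}) i b j := by
      intro j; simp only [E, hy]; erw [e.apply_symm_apply]
    have := LinearMap.congr_fun hx y
    rw [LinearMap.mk₂_apply, Finset.sum_eq_single i] at this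
    · rw [hEy, DirectSum.of_eq_same] at this; exact hb this
    · intro j _ hj
      rw [hEy, DirectSum.of_eq_of_ne _ _ _ hj]; simp
    · simp
  · intro x y
    simp only [LinearMap.mk₂_apply, ET]
    refine Finset.sum_congr rfl fun i _ => ?_
    congr 1; ring

lemma exists_dual {F V : Type*} [Field F] [AddCommGroup V] [Module F V] [FiniteDimensional F V]
    (T : V →ₗ[F] V) : ∃ ψ : Submodule F V → Submodule F V, Function.Injective ψ ∧
      ∀ U, U ≤ U.comap T → ψ U ≤ (ψ U).comap T ∧ finrank F U + finrank F (ψ U) = finrank F V := by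
  obtain ⟨B, hB, hT⟩ := exists_form T
  let e : V ≃ₗ[F] Dual F V := LinearEquiv.ofInjectiveOfFinrankEq B hB (Subspace.dual_finrank_eq).symm
  have he : ∀ x, e x = B x := fun x => rfl
  refine ⟨fun U => (U.dualAnnihilator).comap e.toLinearMap, ?_, ?_⟩
  · intro U U' h
    exact Subspace.dualAnnihilator_inj.1 (Submodule.comap_injective_of_surjective e.surjective h)
  · intro U hU
    refine ⟨?_, ?_⟩
    · intro x hx
      simp only [Submodule.mem_comap, Submodule.mem_dualAnnihilator, LinearEquiv.coe_coe, he] at hx ⊢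
      intro w hw
      rw [hT]; exact hx _ (hU hw)
    · rw [← Subspace.finrank_add_finrank_dualAnnihilator_eq U]
      congr 1
      change finrank F (U.dualAnnihilator.comap (e.symm.symm : V →ₗ[F] Dual F V)) = _
      rw [← Submodule.map_equiv_eq_comap_symm e.symm]
      exact LinearEquiv.finrank_map_eq _ _

lemma exists_dual_ge {F V : Type*} [Field F] [AddCommGroup V] [Module F V] [FiniteDimensional F V]
    (T : V →ₗ[F] V) (A : Submodule F V) (hA : A ≤ A.comap T) :
    ∃ ψ : Submodule F V → Submodule F V, Set.InjOn ψ {U | A ≤ U} ∧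
      ∀ U, A ≤ U → U ≤ U.comap T → A ≤ ψ U ∧ ψ U ≤ (ψ U).comap T ∧
        finrank F U + finrank F (ψ U) = finrank F V + finrank F A := by
  obtain ⟨ψ, hψ, h⟩ := exists_dual (A.mapQ A T hA)
  have hd : ∀ U' : Submodule F (V ⧸ A), finrank F (U'.comap A.mkQ) = finrank F U' + finrank F A := by
    intro U'
    have h1 := (A.mkQ.domRestrict (U'.comap A.mkQ)).finrank_range_add_finrank_ker
    rw [← h1]
    congr 1
    · rw [LinearMap.range_domRestrict, Submodule.map_comap_eq_of_surjective A.mkQ_surjective]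
    · rw [LinearMap.ker_domRestrict, Submodule.ker_mkQ]
      exact ((Submodule.submoduleOfEquivOfLe (by simpa using Submodule.comap_mono (f := A.mkQ) (bot_le : ⊥ ≤ U'))).finrank_eq)
  have hc : ∀ U, A ≤ U → (U.map A.mkQ).comap A.mkQ = U := by
    intro U hU; rw [Submodule.comap_map_mkQ]; exact sup_eq_right.2 hU
  refine ⟨fun U => (ψ (U.map A.mkQ)).comap A.mkQ, ?_, ?_⟩
  · intro U hU U' hU' heq
    have := hψ (Submodule.comap_injective_of_surjective A.mkQ_surjective heq)
    rw [← hc U hU, this, hc U' hU']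
  · intro U hU hT
    have hinv : U.map A.mkQ ≤ (U.map A.mkQ).comap (A.mapQ A T hA) := by
      rintro _ ⟨u, hu, rfl⟩
      exact ⟨T u, hT hu, rfl⟩
    obtain ⟨h1, h2⟩ := h _ hinv
    refine ⟨?_, ?_, ?_⟩
    · intro x hx
      have : A.mkQ x = 0 := by simpa using hx
      rw [Submodule.mem_comap, this]; exact zero_mem _
    · intro x hx
      exact h1 hx
    · have h3 := hd (U.map A.mkQ)
      have h4 := hd (ψ (U.map A.mkQ))
      have h5 := A.finrank_quotient_add_finrank
      rw [hc U hU] at h3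
      dsimp only
      omega

lemma exists_dual_between {F V : Type*} [Field F] [AddCommGroup V] [Module F V] [FiniteDimensional F V]
    (T : V →ₗ[F] V) (A C : Submodule F V) (hA : A ≤ A.comap T) (hC : C ≤ C.comap T) (hAC : A ≤ C) :
    ∃ ψ : Submodule F V → Submodule F V, Set.InjOn ψ {U | A ≤ U ∧ U ≤ C} ∧
      ∀ U, A ≤ U → U ≤ C → U ≤ U.comap T → A ≤ ψ U ∧ ψ U ≤ C ∧ ψ U ≤ (ψ U).comap T ∧
        finrank F U + finrank F (ψ U) = finrank F C + finrank F A := by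
  obtain ⟨ψ, hψ, h⟩ := exists_dual_ge (T.restrict hC) (A.comap C.subtype) (fun x hx => hA hx)
  have hc : ∀ U, U ≤ C → (U.comap C.subtype).map C.subtype = U := by
    intro U hU; rw [Submodule.map_comap_subtype]; exact inf_eq_right.2 hU
  have hd : ∀ U' : Submodule F C, finrank F (U'.map C.subtype) = finrank F U' := fun U' =>
    (Submodule.equivMapOfInjective _ C.injective_subtype U').finrank_eq.symm
  refine ⟨fun U => (ψ (U.comap C.subtype)).map C.subtype, ?_, ?_⟩
  · intro U hU U' hU' heq
    have := hψ (Submodule.comap_mono hU.1) (Submodule.comap_mono hU'.1)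
      (Submodule.map_injective_of_injective C.injective_subtype heq)
    rw [← hc U hU.2, this, hc U' hU'.2]
  · intro U hU hUC hT
    obtain ⟨h1, h2, h3⟩ := h (U.comap C.subtype) (Submodule.comap_mono hU) (fun x hx => hT hx)
    refine ⟨?_, Submodule.map_subtype_le _ _, ?_, ?_⟩
    · rw [← hc A hAC]; exact Submodule.map_mono h1
    · rintro _ ⟨u, hu, rfl⟩
      exact ⟨_, h2 hu, rfl⟩
    · rw [← hd, ← hd (A.comap _), hc U hUC, hc A hAC] at h3
      rw [hd]; exact h3

lemma Xflag_swap_le {F : Type} [Field F] [Fintype F] {n m : ℕ} (Δ : Matrix (Fin n) (Fin n) F)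
    (α : Fin (m + 1) → ℕ) (k : Fin m) :
    Xflag Δ α ≤ Xflag Δ (α ∘ Equiv.swap k.castSucc k.succ) := by
  classical
  let V := Submodule F (Fin n → F)
  have key : ∀ A C : V, ∃ ψ : V → V, A.map Δ.mulVecLin ≤ A → C.map Δ.mulVecLin ≤ C → A ≤ C →
      Set.InjOn ψ {U | A ≤ U ∧ U ≤ C} ∧
      ∀ U, A ≤ U → U ≤ C → U.map Δ.mulVecLin ≤ U → A ≤ ψ U ∧ ψ U ≤ C ∧
        (ψ U).map Δ.mulVecLin ≤ ψ U ∧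
        finrank F U + finrank F (ψ U) = finrank F C + finrank F A := by
    intro A C
    by_cases h : A.map Δ.mulVecLin ≤ A ∧ C.map Δ.mulVecLin ≤ C ∧ A ≤ C
    · obtain ⟨ψ, h1, h2⟩ := exists_dual_between Δ.mulVecLin A C (Submodule.map_le_iff_le_comap.1 h.1)
        (Submodule.map_le_iff_le_comap.1 h.2.1) h.2.2
      refine ⟨ψ, fun _ _ _ => ⟨h1, ?_⟩⟩
      simpa only [Submodule.map_le_iff_le_comap] using h2
    · exact ⟨id, fun a b c => absurd ⟨a, b, c⟩ h⟩
  choose ψ hψ using key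
  -- indices
  let i0 : Fin (m + 2) := k.castSucc.castSucc
  let i1 : Fin (m + 2) := k.succ.castSucc
  let i2 : Fin (m + 2) := k.succ.succ
  have v0 : (i0 : ℕ) = k := rfl
  have v1 : (i1 : ℕ) = k + 1 := rfl
  have v2 : (i2 : ℕ) = k + 2 := rfl
  have h01 : i0 ≤ i1 := by rw [Fin.le_def]; omega
  have h12 : i1 ≤ i2 := by rw [Fin.le_def]; omega
  have n01 : i0 ≠ i1 := by rw [Ne, Fin.ext_iff]; omega
  have n21 : i2 ≠ i1 := by rw [Ne, Fin.ext_iff]; omega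
  unfold Xflag
  refine Nat.card_le_card_of_injective (fun W => ⟨Function.update W.1 i1
    (ψ (W.1 i0) (W.1 i2) (W.1 i1)), ?_⟩) ?_
  · obtain ⟨W, hm, hb, ht, hi, hd⟩ := W
    obtain ⟨-, hq⟩ := hψ (W i0) (W i2) (hi _) (hi _) (hm (h01.trans h12))
    obtain ⟨q1, q2, q3, q4⟩ := hq (W i1) (hm h01) (hm h12) (hi _)
    dsimp only
    set P := ψ (W i0) (W i2) (W i1) with hP
    refine ⟨?_, ?_, ?_, ?_, ?_⟩
    · intro a b hab
      by_cases ha : a = i1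
      · by_cases hb' : b = i1
        · subst ha; subst hb'; exact le_rfl
        · rw [Function.update_of_ne hb', ha, Function.update_self]
          refine q2.trans (hm ?_)
          rw [Fin.le_def] at hab ⊢
          rw [Fin.ext_iff] at ha hb'
          omega
      · by_cases hb' : b = i1
        · rw [Function.update_of_ne ha, hb', Function.update_self]
          refine le_trans (hm ?_) q1
          rw [Fin.le_def] at hab ⊢
          rw [Fin.ext_iff] at ha hb'
          omega
        · rw [Function.update_of_ne ha, Function.update_of_ne hb']; exact hm hab
    · rw [Function.update_of_ne]; · exact hb
      rw [Ne, Fin.ext_iff, v1]; simp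
    · rw [Function.update_of_ne]; · exact ht
      rw [Ne, Fin.ext_iff, v1, Fin.val_last]; omega
    · intro i
      by_cases h : i = i1
      · subst h; rw [Function.update_self]; exact q3
      · rw [Function.update_of_ne h]; exact hi i
    · have d0 : finrank F (W i1) = finrank F (W i0) + α k.castSucc := by
        have := hd k.castSucc
        rw [Fin.succ_castSucc] at this; exact this
      have d1 : finrank F (W i2) = finrank F (W i1) + α k.succ := hd k.succ
      intro i
      by_cases e0 : i = k.castSucc
      · subst e0
        rw [Fin.succ_castSucc, Function.comp_apply, Equiv.swap_apply_left]
        change finrank F (Function.update W i1 P i1 : V) = finrank F (Function.update W i1 P i0 : V) + _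
        rw [Function.update_self, Function.update_of_ne n01]
        omega
      · by_cases e1 : i = k.succ
        · subst e1
          rw [Function.comp_apply, Equiv.swap_apply_right]
          change finrank F (Function.update W i1 P i2 : V) = finrank F (Function.update W i1 P i1 : V) + _
          rw [Function.update_self, Function.update_of_ne n21]
          omega
        · rw [Function.comp_apply, Equiv.swap_apply_of_ne_of_ne e0 e1, Function.update_of_ne,
            Function.update_of_ne]
          · exact hd i
          · rw [Ne, Fin.ext_iff, v1, Fin.val_castSucc]
            rw [Fin.ext_iff, Fin.val_succ] at e1; exact e1
          · rw [Ne, Fin.ext_iff, v1, Fin.val_succ]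
            rw [Fin.ext_iff, Fin.val_castSucc] at e0; omega
  · rintro ⟨W, hm, hb, ht, hi, hd⟩ ⟨W', hm', hb', ht', hi', hd'⟩ heq
    simp only [Subtype.mk.injEq] at heq ⊢
    have hne : ∀ j, j ≠ i1 → W j = W' j := by
      intro j hj
      have := congrFun heq j
      rwa [Function.update_of_ne hj, Function.update_of_ne hj] at this
    have h1 := congrFun heq i1
    rw [Function.update_self, Function.update_self, ← hne _ n01, ← hne _ n21] at h1
    obtain ⟨hinj, -⟩ := hψ (W i0) (W i2) (hi _) (hi _) (hm (h01.trans h12))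
    have h2 : W i1 = W' i1 := hinj ⟨hm h01, hm h12⟩
      ⟨by rw [hne _ n01]; exact hm' h01, by rw [hne _ n21]; exact hm' h12⟩ h1
    funext j
    by_cases hj : j = i1
    · rw [hj, h2]
    · exact hne j hj

lemma Xflag_perm_le {F : Type} [Field F] [Fintype F] {n m : ℕ} (Δ : Matrix (Fin n) (Fin n) F)
    (π : Equiv.Perm (Fin m)) : ∀ α : Fin m → ℕ, Xflag Δ α ≤ Xflag Δ (α ∘ π) := by
  cases m with
  | zero => intro α; rw [Subsingleton.elim (α ∘ π) α]
  | succ m =>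
    have hπ : π ∈ Submonoid.closure
        (Set.range fun i : Fin m ↦ Equiv.swap i.castSucc i.succ) := by
      rw [Equiv.Perm.mclosure_swap_castSucc_succ]; trivial
    induction hπ using Submonoid.closure_induction with
    | mem x hx => obtain ⟨k, rfl⟩ := hx; intro α; exact Xflag_swap_le Δ α k
    | one => intro α; exact le_rfl
    | mul x y _ _ hx hy => intro α; exact (hx α).trans (hy (α ∘ x))

/-- If `α'` is a rearrangement of the weak composition `α` of `n`, then
`X_α(Δ) = X_{α'}(Δ)` for every matrix `Δ` over a finite field. -/
theorem statement1 (q : ℕ) (hq : IsPrimePow q) (n : ℕ) (hn : 0 < n)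
    (F : Type) [Field F] [Fintype F] (hF : Fintype.card F = q)
    (Δ : Matrix (Fin n) (Fin n) F) (ℓ : ℕ) (α α' : Fin ℓ → ℕ)
    (hsum : ∑ i, α i = n) (hperm : ∃ π : Equiv.Perm (Fin ℓ), ∀ i, α' i = α (π i)) :
    Xflag Δ α = Xflag Δ α' := by
  obtain ⟨π, hπ⟩ := hperm
  obtain rfl : α' = α ∘ π := funext hπ
  apply le_antisymm (Xflag_perm_le Δ π α)
  have := Xflag_perm_le Δ π⁻¹ (α ∘ π)
  have e : (α ∘ π) ∘ (π⁻¹ : Equiv.Perm (Fin ℓ)) = α := by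
    funext i; simp
  rwa [e] at this
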